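/- arXiv:1512.04215 — 4 statements merged into one kernel-verified Lean document; each statement's English description precedes it below -/
import Mathlib

section
/- Ehrenpreis–Malgrange lower bound on spheres: Let P(q) = Σ_{n=0}^m qⁿaₙ be a slice regular polynomial of degree m with leading coefficient a_m ≠ 0. Let p be the number of distinct 2-spheres [w] on which P vanishes identically (spherical zeros), let t be the number of distinct zeros of P not belonging to any such sphere (isolated zeros), and set M = p + t. Then for every R > 0 there exists r with 0 < r < R such that |P(q)| ≥ |a_m|·(R/(2(M+1)))^m for every q ∈ ℍ with |q| = r. -/
open Quaternion
open scoped InnerProductSpace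

/-- The sphere `𝕊` of purely imaginary unit quaternions. -/
def QSphere : Set ℍ := {q : ℍ | q ^ 2 = -1}

/-- The complex plane `ℂ_I` through `1` and `I`. -/
def slicePlane (I : ℍ) : Set ℍ := {q : ℍ | ∃ x y : ℝ, q = (x : ℍ) + y • I}

/-- A real differentiable `f` is (left) slice regular on `U` if on every slice `U ∩ ℂ_I`
it satisfies the Cauchy-Riemann equation `∂f/∂x + I ∂f/∂y = 0`. -/
def SliceRegularOn (f : ℍ → ℍ) (U : Set ℍ) : Prop :=
  DifferentiableOn ℝ f U ∧
    ∀ I ∈ QSphere, ∀ q ∈ U ∩ slicePlane I,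
      fderiv ℝ f q 1 + I * fderiv ℝ f q I = 0

/-- The 2-sphere `[w] = {Re(w) + |Im(w)|I : I ∈ 𝕊}` determined by `w`. -/
noncomputable def sphereOf (w : ℍ) : Set ℍ :=
  {q : ℍ | ∃ I ∈ QSphere, q = (w.re : ℍ) + ‖w.im‖ • I}

/-- The value at `q` of the slice regular polynomial `∑_{n ≤ m} qⁿ aₙ`. -/
noncomputable def sliceEval (m : ℕ) (a : ℕ → ℍ) (q : ℍ) : ℍ :=
  ∑ n ∈ Finset.range (m + 1), q ^ n * a n

/-- Division with remainder by a linear factor: `P(q) - P(l) = ∑ qⁿ (q - l) bₙ`, where the last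
coefficient `bₘ` is the leading coefficient of `P`. -/
theorem exists_sliceEval_sub_eq (l : ℍ) (m : ℕ) (a : ℕ → ℍ) :
    ∃ b : ℕ → ℍ, b m = a (m + 1) ∧ ∀ q : ℍ,
      sliceEval (m + 1) a q - sliceEval (m + 1) a l = sliceEval m (fun n => (q - l) * b n) q := by
  induction m generalizing a with
  | zero =>
    refine ⟨fun _ => a 1, rfl, fun q => ?_⟩
    simp [sliceEval, Finset.sum_range_succ, sub_mul]
  | succ m ih =>
    obtain ⟨b, hb, h⟩ := ih (fun n => a (n + 1))
    have shift : ∀ (k : ℕ) (c : ℕ → ℍ) (q : ℍ),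
        sliceEval (k + 1) c q = q * sliceEval k (fun n => c (n + 1)) q + c 0 := by
      intro k c q
      simp only [sliceEval]
      rw [Finset.sum_range_succ' _ (k + 1), Finset.mul_sum]
      simp [pow_succ', mul_assoc]
    refine ⟨fun | 0 => sliceEval (m + 1) (fun n => a (n + 1)) l | n + 1 => b n, hb,
      fun q => ?_⟩
    rw [shift (m + 1) a q, shift (m + 1) a l, shift m (fun n => (q - l) * _), ← h q]
    dsimp only
    noncomm_ring

/-- Conjugating the argument: `c P(c⁻¹ q c)` is `∑ qⁿ c aₙ`. -/
theorem sliceEval_mul_left {c : ℍ} (hc : c ≠ 0) (m : ℕ) (a : ℕ → ℍ) (q : ℍ) :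
    sliceEval m (fun n => c * a n) q = c * sliceEval m a (c⁻¹ * q * c) := by
  simp only [sliceEval, Finset.mul_sum]
  have h : ∀ n : ℕ, (c⁻¹ * q * c) ^ n = c⁻¹ * q ^ n * c := by
    intro n
    induction n with
    | zero => simp [hc]
    | succ n ih => rw [pow_succ, pow_succ, ih]; simp [mul_assoc, hc]
  refine Finset.sum_congr rfl fun n _ => ?_
  rw [h]
  simp [← mul_assoc, hc]

theorem norm_inv_mul_mul {c : ℍ} (hc : c ≠ 0) (q : ℍ) : ‖c⁻¹ * q * c‖ = ‖q‖ := by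
  have : ‖c‖ ≠ 0 := norm_ne_zero_iff.mpr hc
  rw [norm_mul, norm_mul, norm_inv]
  field_simp

theorem commute_mul_star_sub (u v : ℍ) : Commute u (u * star v - star v * star u) := by
  rw [commute_iff_eq]
  ext <;> simp <;> ring

/-- Multiplying by a linear factor on the left moves the zeros only along their spheres. -/
theorem exists_zero_norm_eq {m : ℕ} {b : ℕ → ℍ} {l u : ℍ} (hu : sliceEval m b u = 0) :
    ∃ q : ℍ, ‖q‖ = ‖u‖ ∧ sliceEval m (fun n => (q - l) * b n) q = 0 := by
  by_cases hv : l - star u = 0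
  · refine ⟨l, ?_, by simp [sliceEval]⟩
    rw [sub_eq_zero.mp hv, norm_star]
  set v := l - star u with hvdef
  have hl : l = v + star u := by rw [hvdef]; abel
  have hvi : v⁻¹ ≠ 0 := inv_ne_zero hv
  have hinv : v⁻¹ = (normSq v)⁻¹ • star v := rfl
  have hcomm : Commute u (u * v⁻¹ - v⁻¹ * l) := by
    have h : u * v⁻¹ - v⁻¹ * l = (normSq v)⁻¹ • (u * star v - star v * star u) - 1 := by
      have h1 : v⁻¹ * l = 1 + v⁻¹ * star u := by rw [hl, mul_add, inv_mul_cancel₀ hv]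
      rw [h1, hinv, smul_sub, mul_smul_comm, smul_mul_assoc]
      abel
    rw [h]
    exact ((commute_mul_star_sub u v).smul_right _).sub_right (Commute.one_right u)
  refine ⟨v * u * v⁻¹, by simpa using norm_inv_mul_mul hvi u, ?_⟩
  have hfac : ∀ n, (v * u * v⁻¹ - l) * b n = v * ((u * v⁻¹ - v⁻¹ * l) * b n) := by
    intro n
    rw [← mul_assoc, mul_sub, ← mul_assoc, ← mul_assoc, mul_inv_cancel₀ hv, one_mul]
  simp only [hfac]
  rw [sliceEval_mul_left hv, show v⁻¹ * (v * u * v⁻¹) * v = u by simp [mul_assoc, hv]]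
  have : sliceEval m (fun n => (u * v⁻¹ - v⁻¹ * l) * b n) u
      = (u * v⁻¹ - v⁻¹ * l) * sliceEval m b u := by
    simp only [sliceEval, Finset.mul_sum]
    refine Finset.sum_congr rfl fun n _ => ?_
    rw [← mul_assoc, (hcomm.pow_left n).eq, mul_assoc]
  rw [this, hu, mul_zero, mul_zero]

theorem pow_re_add_im_mul {J : ℍ} (hJ : J * J = -1) (z : ℂ) (n : ℕ) :
    ((z.re : ℍ) + (z.im : ℍ) * J) ^ n = ((z ^ n).re : ℍ) + ((z ^ n).im : ℍ) * J := by
  have h := map_pow (Complex.lift ⟨J, hJ⟩) z n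
  simpa [Complex.lift, Complex.liftAux_apply, ← Quaternion.coe_mul_eq_smul,
    Quaternion.algebraMap_def] using h.symm

/-- Fundamental theorem of algebra for slice regular polynomials. -/
theorem exists_sliceEval_eq_zero {m : ℕ} (hm : 0 < m) {a : ℕ → ℍ} (ham : a m ≠ 0) :
    ∃ q : ℍ, sliceEval m a q = 0 := by
  let p : (ℍ →ₗ[ℝ] ℝ) → Polynomial ℂ := fun f =>
    ∑ n ∈ Finset.range (m + 1), Polynomial.C ((f (a n) : ℝ) : ℂ) * Polynomial.X ^ n
  have hdeg : ∀ f, (p f).natDegree ≤ m := fun f =>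
    Polynomial.natDegree_sum_le_of_forall_le _ _ fun n hn =>
      (Polynomial.natDegree_C_mul_X_pow_le _ _).trans (by simpa [Nat.lt_succ_iff] using hn)
  have hcoeff : ∀ f, (p f).coeff m = ((f (a m) : ℝ) : ℂ) := by
    intro f
    simp [p, Polynomial.finsetSum_coeff, Polynomial.coeff_C_mul, Polynomial.coeff_X_pow]
  have hsq : ∀ f, (p f * p f).coeff (m + m) = ((f (a m) * f (a m) : ℝ) : ℂ) := by
    intro f
    rw [Polynomial.coeff_mul_add_eq_of_natDegree_le (hdeg f) (hdeg f), hcoeff]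
    push_cast
    rfl
  obtain ⟨fre, hre⟩ : ∃ f : ℍ →ₗ[ℝ] ℝ, ∀ q, f q = q.re :=
    ⟨⟨⟨fun q => q.re, by simp⟩, by simp⟩, fun _ => rfl⟩
  obtain ⟨fimI, himI⟩ : ∃ f : ℍ →ₗ[ℝ] ℝ, ∀ q, f q = q.imI :=
    ⟨⟨⟨fun q => q.imI, by simp⟩, by simp⟩, fun _ => rfl⟩
  obtain ⟨fimJ, himJ⟩ : ∃ f : ℍ →ₗ[ℝ] ℝ, ∀ q, f q = q.imJ :=
    ⟨⟨⟨fun q => q.imJ, by simp⟩, by simp⟩, fun _ => rfl⟩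
  obtain ⟨fimK, himK⟩ : ∃ f : ℍ →ₗ[ℝ] ℝ, ∀ q, f q = q.imK :=
    ⟨⟨⟨fun q => q.imK, by simp⟩, by simp⟩, fun _ => rfl⟩
  set N : Polynomial ℂ := p fre * p fre +
    p fimI * p fimI + p fimJ * p fimJ +
    p fimK * p fimK with hN
  have hNcoeff : N.coeff (m + m) ≠ 0 := by
    simp only [hN, Polynomial.coeff_add, hsq, hre, himI, himJ, himK]
    rw [← Complex.ofReal_add, ← Complex.ofReal_add, ← Complex.ofReal_add, Complex.ofReal_ne_zero]
    have := Quaternion.normSq_ne_zero.mpr ham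
    rw [Quaternion.normSq_def'] at this
    simpa only [sq] using this
  have hNdeg : 0 < N.degree :=
    lt_of_lt_of_le (by exact_mod_cast (by omega : 0 < m + m))
      (Polynomial.le_degree_of_ne_zero hNcoeff)
  obtain ⟨z, hz⟩ := Complex.exists_root hNdeg
  set x : ℍ := ∑ n ∈ Finset.range (m + 1), (z ^ n).re • a n with hx
  set y : ℍ := ∑ n ∈ Finset.range (m + 1), (z ^ n).im • a n with hy
  have heval : ∀ {J : ℍ}, J * J = -1 →
      sliceEval m a ((z.re : ℍ) + (z.im : ℍ) * J) = x + J * y := by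
    intro J hJ
    simp only [sliceEval, pow_re_add_im_mul hJ, hx, hy, Finset.mul_sum, ← Finset.sum_add_distrib]
    refine Finset.sum_congr rfl fun n _ => ?_
    rw [add_mul, Quaternion.coe_mul_eq_smul, (Quaternion.coe_commutes _ J), mul_assoc,
      Quaternion.coe_mul_eq_smul]
  have hpz : ∀ f : ℍ →ₗ[ℝ] ℝ, (p f).eval z = ⟨f x, f y⟩ := by
    intro f
    apply Complex.ext <;>
      simp [p, Polynomial.eval_finsetSum, hx, hy, map_sum, mul_comm (f _)]
  have hsum : normSq x = normSq y ∧ (x * star y).re = 0 := by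
    rw [Polynomial.IsRoot.def, hN] at hz
    simp only [Polynomial.eval_add, Polynomial.eval_mul, hpz] at hz
    have hz_re := congrArg Complex.re hz
    have hz_im := congrArg Complex.im hz
    simp [hre, himI, himJ, himK] at hz_re hz_im
    rw [Quaternion.normSq_def', Quaternion.normSq_def']
    constructor
    · linarith
    · simp
      linarith
  obtain ⟨hxy, hperp⟩ := hsum
  by_cases hy0 : y = 0
  · have hx0 : x = 0 := by rwa [hy0, map_zero, Quaternion.normSq_eq_zero] at hxy
    obtain ⟨J, hJ0, hJ1, hJ2, hJ3⟩ : ∃ J : ℍ, J.re = 0 ∧ J.imI = 1 ∧ J.imJ = 0 ∧ J.imK = 0 :=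
      ⟨⟨0, 1, 0, 0⟩, rfl, rfl, rfl, rfl⟩
    have hJ : J * J = -1 := by ext <;> simp [hJ0, hJ1, hJ2, hJ3]
    exact ⟨_, (heval hJ).trans (by simp [hx0, hy0])⟩
  · have hnorm : normSq (-(x * y⁻¹)) = 1 := by
      rw [Quaternion.normSq_neg, map_mul, map_inv₀, hxy,
        mul_inv_cancel₀ (Quaternion.normSq_ne_zero.mpr hy0)]
    have hJre : (-(x * y⁻¹)).re = 0 := by
      rw [show y⁻¹ = (normSq y)⁻¹ • star y from rfl, mul_smul_comm]
      simpa only [Quaternion.re_neg, Quaternion.re_smul, hperp, smul_zero] using neg_zero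
    have hJ : -(x * y⁻¹) * -(x * y⁻¹) = -1 := by
      rw [← sq, Quaternion.sq_eq_neg_normSq.mpr hJre, hnorm, Quaternion.coe_one]
    exact ⟨_, (heval hJ).trans (by rw [neg_mul, inv_mul_cancel_right₀ hy0, add_neg_cancel])⟩

/-- A slice regular polynomial whose zeros all have norm at distance at least `δ` from `r` is
bounded below by `‖aₘ‖ δᵐ` on the sphere of radius `r`. -/
theorem mul_pow_le_norm_sliceEval (m : ℕ) {a : ℕ → ℍ} (ham : a m ≠ 0) {r δ : ℝ} (hδ : 0 ≤ δ)
    (hzero : ∀ q, sliceEval m a q = 0 → δ ≤ |r - ‖q‖|) {q : ℍ} (hq : ‖q‖ = r) :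
    ‖a m‖ * δ ^ m ≤ ‖sliceEval m a q‖ := by
  induction m generalizing a q with
  | zero => simp [sliceEval]
  | succ m ih =>
    obtain ⟨l, hl⟩ := exists_sliceEval_eq_zero m.succ_pos ham
    obtain ⟨b, hb, hab⟩ := exists_sliceEval_sub_eq l m a
    simp only [hl, sub_zero] at hab
    by_cases hc : q - l = 0
    · have h := hzero l hl
      rw [← sub_eq_zero.mp hc, hq, sub_self, abs_zero] at h
      simp [le_antisymm h hδ]
    rw [hab, sliceEval_mul_left hc, norm_mul, pow_succ', ← hb, mul_left_comm]
    have hbm : b m ≠ 0 := hb ▸ ham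
    refine mul_le_mul ?_ (ih hbm ?_ ((norm_inv_mul_mul hc q).trans hq)) (by positivity)
      (norm_nonneg _)
    · exact (hzero l hl).trans (hq ▸ abs_norm_sub_norm_le q l)
    · intro u hu
      obtain ⟨w, hw, hw0⟩ := exists_zero_norm_eq (l := l) hu
      exact hw ▸ hzero w ((hab w).trans hw0)

/-- Among `M + 1` disjoint intervals of length `2δ`, one avoids a given set of at most `M` reals. -/
theorem exists_forall_le_abs_sub (D : Finset ℝ) {M : ℕ} (hD : D.card ≤ M) {δ : ℝ} (hδ : 0 < δ) :
    ∃ k : ℕ, k ≤ M ∧ ∀ x ∈ D, δ ≤ |(2 * k + 1) * δ - x| := by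
  by_contra! h
  have h' : ∀ k ∈ Finset.range (M + 1), ∃ x ∈ D, |(2 * k + 1) * δ - x| < δ := fun k hk =>
    h k (Nat.lt_succ_iff.mp (Finset.mem_range.mp hk))
  choose! f hf hfd using h'
  obtain ⟨i, hi, j, hj, hij, hfij⟩ := Finset.exists_ne_map_eq_of_card_lt_of_maps_to
    (by simpa [Nat.lt_succ_iff] using hD : D.card < (Finset.range (M + 1)).card) hf
  have hi' := abs_lt.mp (hfd i hi)
  have hj' := abs_lt.mp (hfd j hj)
  rw [hfij] at hi'
  have key : ∀ {i j : ℕ}, i < j → (2 * i + 1) * δ + 2 * δ ≤ (2 * j + 1) * δ := by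
    intro i j hlt
    have : (i : ℝ) + 1 ≤ j := by exact_mod_cast hlt
    nlinarith
  rcases lt_or_gt_of_ne hij with hlt | hlt
  · linarith [key hlt]
  · linarith [key hlt]

theorem norm_eq_of_mem_sphereOf {w q : ℍ} (hq : q ∈ sphereOf w) : ‖q‖ = ‖w‖ := by
  obtain ⟨I, hI, rfl⟩ := hq
  have hI2 : I ^ 2 = -1 := hI
  have hnorm : normSq I = 1 := by
    have h := congrArg normSq hI2
    rw [map_pow, Quaternion.normSq_neg, map_one] at h
    exact (pow_eq_one_iff_of_nonneg Quaternion.normSq_nonneg two_ne_zero).mp h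
  have hre : I.re = 0 := Quaternion.sq_eq_neg_normSq.mp (by rw [hI2, hnorm, Quaternion.coe_one])
  have him := Quaternion.normSq_eq_norm_mul_self w.im
  rw [← mul_self_inj_of_nonneg (norm_nonneg _) (norm_nonneg _),
    ← Quaternion.normSq_eq_norm_mul_self, ← Quaternion.normSq_eq_norm_mul_self]
  rw [Quaternion.normSq_def'] at hnorm him ⊢
  rw [Quaternion.normSq_def']
  simp [hre] at hnorm him ⊢
  linear_combination ‖w.im‖ ^ 2 * hnorm - him

/-- **Ehrenpreis–Malgrange lower bound on spheres.** Let `P(q) = Σ_{n≤m} qⁿaₙ` be a slice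
regular polynomial of degree `m` (`aₘ ≠ 0`), with `p` distinct spherical zeros and `t`
distinct isolated zeros, `M = p + t`.  For every `R > 0` there is `0 < r < R` such that
`|P(q)| ≥ |aₘ| (R/(2(M+1)))^m` on the sphere `|q| = r`. -/
theorem ehrenpreis_malgrange_sphere (m : ℕ) (a : ℕ → ℍ) (ham : a m ≠ 0)
    (P : ℍ → ℍ) (hP : ∀ q : ℍ, P q = ∑ n ∈ Finset.range (m + 1), q ^ n * a n)
    (SZ : Set (Set ℍ))
    (hSZ : SZ = {s | ∃ w : ℍ, w.im ≠ 0 ∧ s = sphereOf w ∧ ∀ q ∈ s, P q = 0})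
    (IZ : Set ℍ) (hIZ : IZ = {q : ℍ | P q = 0 ∧ ∀ s ∈ SZ, q ∉ s})
    (p t : ℕ) (hSZfin : SZ.Finite) (hp : SZ.ncard = p)
    (hIZfin : IZ.Finite) (ht : IZ.ncard = t)
    (R : ℝ) (hR : 0 < R) :
    ∃ r : ℝ, 0 < r ∧ r < R ∧
      ∀ q : ℍ, ‖q‖ = r →
        ‖a m‖ * (R / (2 * ((p : ℝ) + t + 1))) ^ m ≤ ‖P q‖ := by
  classical
  have hnorm : ∀ s ∈ SZ, ∃ x : ℝ, ∀ q ∈ s, ‖q‖ = x := by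
    intro s hs
    rw [hSZ] at hs
    obtain ⟨w, -, rfl, -⟩ := hs
    exact ⟨‖w‖, fun q hq => norm_eq_of_mem_sphereOf hq⟩
  choose! f hf using hnorm
  set D : Finset ℝ := hSZfin.toFinset.image f ∪ hIZfin.toFinset.image (fun q => ‖q‖)
  have hD : D.card ≤ p + t := by
    refine (Finset.card_union_le _ _).trans (add_le_add ?_ ?_)
    · rw [← hp, Set.ncard_eq_toFinset_card SZ hSZfin]
      exact Finset.card_image_le
    · rw [← ht, Set.ncard_eq_toFinset_card IZ hIZfin]
      exact Finset.card_image_le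
  have hmem : ∀ q, P q = 0 → ‖q‖ ∈ D := by
    intro q hq
    rw [Finset.mem_union]
    by_cases h : ∃ s ∈ SZ, q ∈ s
    · obtain ⟨s, hs, hqs⟩ := h
      exact Or.inl (Finset.mem_image.mpr ⟨s, by simpa using hs, (hf s hs q hqs).symm⟩)
    · push Not at h
      have hqI : q ∈ IZ := by rw [hIZ]; exact ⟨hq, h⟩
      exact Or.inr (Finset.mem_image.mpr ⟨q, by simpa using hqI, rfl⟩)
  set δ : ℝ := R / (2 * ((p : ℝ) + t + 1)) with hδdef
  have hδ : 0 < δ := by positivity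
  have hRδ : R = (2 * ((p : ℝ) + t + 1)) * δ := by rw [hδdef]; field_simp
  obtain ⟨k, hk, hkD⟩ := exists_forall_le_abs_sub D hD hδ
  refine ⟨(2 * k + 1) * δ, by positivity, ?_, fun q hq => ?_⟩
  · have : (k : ℝ) ≤ p + t := by exact_mod_cast hk
    rw [hRδ]
    exact mul_lt_mul_of_pos_right (by linarith) hδ
  · rw [hP q]
    exact mul_pow_le_norm_sliceEval m ham hδ.le
      (fun w hw => hkD _ (hmem w ((hP w).trans hw))) hq
end

section
/- Let P(q) = Σ_{n=0}^m qⁿaₙ be a slice regular polynomial of degree m with leading coefficient a_m ≠ 0. For any q₀ = u + vI₀ ∈ ℍ (u, v ∈ ℝ, I₀ ∈ 𝕊) and any R > 0, there exists r with 0 < r < R such that |P(q)| ≥ |a_m|·(R/(2(2m+1)))^m for every q on the compact 3-dimensional hypersurface Γ = {x + yI : x, y ∈ ℝ, (x−u)² + (y−v)² = r², I ∈ 𝕊}. -/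
open Quaternion
open scoped InnerProductSpace

namespace QSphere

lemma norm_eq_one {I : ℍ} (hI : I ∈ QSphere) : ‖I‖ = 1 := by
  have h : I ^ 2 = -1 := hI
  have h2 : ‖I‖ ^ 2 = 1 := by rw [← norm_pow, h, norm_neg, norm_one]
  nlinarith [norm_nonneg I]

lemma re_eq_zero {I : ℍ} (hI : I ∈ QSphere) : I.re = 0 := by
  have h : I ^ 2 = -1 := hI
  have hn : normSq I = 1 := by rw [normSq_eq_norm_mul_self, norm_eq_one hI, one_mul]
  rw [normSq_def'] at hn
  have h0 := congrArg QuaternionAlgebra.re h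
  simp [pow_two] at h0
  nlinarith

lemma mem_of_re_eq_zero_of_norm_eq_one {I : ℍ} (hre : I.re = 0) (hn : ‖I‖ = 1) :
    I ∈ QSphere := by
  have hs : star I = -I := by ext <;> simp [hre]
  have h := self_mul_star I
  rw [hs, normSq_eq_norm_mul_self, hn] at h
  change I ^ 2 = -1
  rw [pow_two, ← neg_eq_iff_eq_neg, ← mul_neg, h]
  simp

lemma conj_mem {I h : ℍ} (hI : I ∈ QSphere) (hh : h ≠ 0) : h⁻¹ * I * h ∈ QSphere := by
  have h2 : I ^ 2 = -1 := hI
  change (h⁻¹ * I * h) ^ 2 = -1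
  calc (h⁻¹ * I * h) ^ 2 = h⁻¹ * I * (h * h⁻¹) * I * h := by
        simp only [pow_two, mul_assoc]
    _ = h⁻¹ * I ^ 2 * h := by rw [mul_inv_cancel₀ hh, mul_one, pow_two, mul_assoc h⁻¹]
    _ = -1 := by rw [h2]; simp [hh]

/-- Powers in the slice `ℂ_I` are computed as in `ℂ`. -/
lemma pow_slice {I : ℍ} (hI : I ∈ QSphere) (z : ℂ) (n : ℕ) :
    ((z.re : ℍ) + z.im • I) ^ n = (((z ^ n).re : ℝ) : ℍ) + (z ^ n).im • I := by
  have h2 : I * I = -1 := by rw [← pow_two]; exact hI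
  have key := map_pow (Complex.lift ⟨I, h2⟩) z n
  simpa [Complex.lift, Complex.liftAux_apply] using key.symm

end QSphere

lemma exists_sphere_add_mul_eq_zero {b c : ℍ} (hn : ‖b‖ = ‖c‖) (hbc : (b * star c).re = 0) :
    ∃ I ∈ QSphere, b + I * c = 0 := by
  by_cases hc : c = 0
  · have hb : b = 0 := by rw [← norm_eq_zero, hn, hc, norm_zero]
    obtain ⟨I, hr, hi, hj, hk⟩ : ∃ I : ℍ, I.re = 0 ∧ I.imI = 1 ∧ I.imJ = 0 ∧ I.imK = 0 :=
      ⟨⟨0, 1, 0, 0⟩, rfl, rfl, rfl, rfl⟩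
    refine ⟨I, ?_, by simp [hb, hc]⟩
    change I ^ 2 = -1
    ext <;> simp [pow_two, hr, hi, hj, hk]
  · have hc' : ‖c‖ ≠ 0 := norm_ne_zero_iff.mpr hc
    refine ⟨-(b * c⁻¹), QSphere.mem_of_re_eq_zero_of_norm_eq_one ?_ ?_, ?_⟩
    · rw [Quaternion.inv_def]
      simp only [mul_smul_comm, re_neg, re_smul, hbc, smul_zero, neg_zero]
    · rw [norm_neg, norm_mul, norm_inv, hn, mul_inv_cancel₀ hc']
    · rw [neg_mul, mul_assoc, inv_mul_cancel₀ hc, mul_one, add_neg_cancel]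

/-- The complex polynomial with the given real coefficients, such as one real
component of the coefficients of a quaternionic polynomial. -/
noncomputable def componentPoly (m : ℕ) (f : ℕ → ℝ) : Polynomial ℂ :=
  ∑ n ∈ Finset.range (m + 1), Polynomial.monomial n (f n : ℂ)

lemma componentPoly_natDegree_le (m : ℕ) (f : ℕ → ℝ) :
    (componentPoly m f).natDegree ≤ m :=
  Polynomial.natDegree_sum_le_of_forall_le _ _ fun _ hn =>
    (Polynomial.natDegree_monomial_le _).trans (Nat.lt_succ_iff.mp (Finset.mem_range.mp hn))

lemma componentPoly_coeff (m : ℕ) (f : ℕ → ℝ) : (componentPoly m f).coeff m = f m := by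
  simp [componentPoly, Polynomial.coeff_monomial]

lemma componentPoly_eval (m : ℕ) (f : ℕ → ℝ) (z : ℂ) :
    (componentPoly m f).eval z =
      ⟨∑ n ∈ Finset.range (m + 1), (z ^ n).re * f n,
        ∑ n ∈ Finset.range (m + 1), (z ^ n).im * f n⟩ := by
  rw [componentPoly, Polynomial.eval_finsetSum]
  apply Complex.ext <;> simp [mul_comm]

/-- A slice regular polynomial of positive degree has a zero. -/
lemma exists_root_sliceRegularPolynomial (m : ℕ) (hm : m ≠ 0) (a : ℕ → ℍ) (ham : a m ≠ 0) :
    ∃ α : ℍ, ∑ n ∈ Finset.range (m + 1), α ^ n * a n = 0 := by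
  let p : Polynomial ℂ := componentPoly m (fun n => (a n).re) ^ 2 +
    componentPoly m (fun n => (a n).imI) ^ 2 + componentPoly m (fun n => (a n).imJ) ^ 2 +
    componentPoly m (fun n => (a n).imK) ^ 2
  have hcoeff : p.coeff (2 * m) = (normSq (a m) : ℝ) := by
    simp only [p, Polynomial.coeff_add,
      Polynomial.coeff_pow_of_natDegree_le (componentPoly_natDegree_le m _),
      componentPoly_coeff, normSq_def']
    push_cast
    ring
  have hdeg : p.degree ≠ 0 := by
    intro h
    have h0 : p.coeff (2 * m) = 0 := Polynomial.coeff_eq_zero_of_degree_lt (by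
      rw [h]; exact_mod_cast Nat.pos_of_ne_zero (by omega))
    rw [hcoeff, Complex.ofReal_eq_zero, normSq_eq_zero] at h0
    exact ham h0
  obtain ⟨z, hz⟩ := IsAlgClosed.exists_root p hdeg
  set b : ℍ := ∑ n ∈ Finset.range (m + 1), (z ^ n).re • a n with hb
  set c : ℍ := ∑ n ∈ Finset.range (m + 1), (z ^ n).im • a n with hc
  have hre : ∀ f : ℕ → ℝ, (∑ n ∈ Finset.range (m + 1), f n • a n) =
      (⟨∑ n ∈ Finset.range (m + 1), f n * (a n).re, ∑ n ∈ Finset.range (m + 1), f n * (a n).imI,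
        ∑ n ∈ Finset.range (m + 1), f n * (a n).imJ,
        ∑ n ∈ Finset.range (m + 1), f n * (a n).imK⟩ : ℍ) := by
    intro f
    induction Finset.range (m + 1) using Finset.induction_on with
    | empty => ext <;> simp
    | insert k s hk ih => simp only [Finset.sum_insert hk, ih]; ext <;> rfl
  have hz' : (⟨b.re, c.re⟩ : ℂ) ^ 2 + (⟨b.imI, c.imI⟩ : ℂ) ^ 2 + (⟨b.imJ, c.imJ⟩ : ℂ) ^ 2 +
      (⟨b.imK, c.imK⟩ : ℂ) ^ 2 = 0 := by
    have h := hz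
    simp only [p, Polynomial.IsRoot.def, Polynomial.eval_add, Polynomial.eval_pow,
      componentPoly_eval] at h
    rw [hb, hc, hre, hre]
    exact h
  have h1 := congrArg Complex.re hz'
  have h2 := congrArg Complex.im hz'
  simp only [pow_two, Complex.add_re, Complex.add_im, Complex.mul_re, Complex.mul_im,
    Complex.zero_re, Complex.zero_im] at h1 h2
  have hn : ‖b‖ = ‖c‖ := by
    have : normSq b = normSq c := by rw [normSq_def', normSq_def']; linarith
    rw [normSq_eq_norm_mul_self, normSq_eq_norm_mul_self] at this
    exact (mul_self_inj (norm_nonneg _) (norm_nonneg _)).mp this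
  have hbc : (b * star c).re = 0 := by
    simp only [re_mul, re_star, imI_star, imJ_star, imK_star]
    linarith
  obtain ⟨I, hI, h0⟩ := exists_sphere_add_mul_eq_zero hn hbc
  refine ⟨(z.re : ℍ) + z.im • I, ?_⟩
  rw [← h0, hb, hc, Finset.mul_sum, ← Finset.sum_add_distrib]
  refine Finset.sum_congr rfl fun n _ => ?_
  rw [QSphere.pow_slice hI, add_mul, coe_mul_eq_smul, smul_mul_assoc, mul_smul_comm]

/-- Synthetic division by `q - α` for polynomials with coefficients on the right. -/
lemma exists_synthetic_division {A : Type*} [Ring A] (α : A) (m : ℕ) (a : ℕ → A) :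
    ∃ c : ℕ → A, c m = a (m + 1) ∧ ∀ q : A,
      ∑ n ∈ Finset.range (m + 2), q ^ n * a n - ∑ n ∈ Finset.range (m + 2), α ^ n * a n =
        ∑ k ∈ Finset.range (m + 1), q ^ k * (q - α) * c k := by
  induction m generalizing a with
  | zero => exact ⟨fun _ => a 1, rfl, fun q => by simp [Finset.sum_range_succ, sub_mul]⟩
  | succ m ih =>
    obtain ⟨c, hc, h⟩ := ih fun n => a (n + 1)
    refine ⟨fun k => Nat.casesOn k (∑ n ∈ Finset.range (m + 2), α ^ n * a (n + 1)) c,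
      hc, fun q => ?_⟩
    have hs : ∀ t : A, ∑ n ∈ Finset.range (m + 1 + 2), t ^ n * a n =
        t * ∑ n ∈ Finset.range (m + 2), t ^ n * a (n + 1) + a 0 := by
      intro t
      rw [Finset.sum_range_succ', Finset.mul_sum]
      simp [pow_succ', mul_assoc]
    rw [hs, hs]
    refine Eq.trans ?_ (Finset.sum_range_succ' _ _).symm
    have h' : ∑ k ∈ Finset.range (m + 1), q ^ (k + 1) * (q - α) * c k =
        q * (∑ n ∈ Finset.range (m + 2), q ^ n * a (n + 1) -
          ∑ n ∈ Finset.range (m + 2), α ^ n * a (n + 1)) := by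
      rw [h q, Finset.mul_sum]
      simp [pow_succ', mul_assoc]
    have hsplit : ∀ S T : A, q * S + a 0 - (α * T + a 0) = q * (S - T) + q ^ 0 * (q - α) * T := by
      intro S T
      rw [pow_zero]
      noncomm_ring
    exact (hsplit _ _).trans (congrArg (· + _) h'.symm)

/-- A slice regular polynomial of degree `m` is bounded below on the sphere `x + y𝕊` by
`‖a m‖ δ ^ m` as soon as that sphere stays at distance `δ` from `m` suitable points. -/
lemma exists_finset_norm_sliceRegularPolynomial_ge (m : ℕ) (a : ℕ → ℍ) (ham : a m ≠ 0) :
    ∃ s : Finset ℍ, s.card ≤ m ∧ ∀ x y δ : ℝ, 0 ≤ δ →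
      (∀ α ∈ s, ∀ J ∈ QSphere, δ ≤ ‖(x : ℍ) + y • J - α‖) → ∀ I ∈ QSphere,
        ‖a m‖ * δ ^ m ≤ ‖∑ n ∈ Finset.range (m + 1), ((x : ℍ) + y • I) ^ n * a n‖ := by
  classical
  induction m generalizing a with
  | zero => exact ⟨∅, by simp, fun x y δ _ _ I _ => by simp⟩
  | succ m ih =>
    obtain ⟨α, hα⟩ := exists_root_sliceRegularPolynomial (m + 1) m.succ_ne_zero a ham
    obtain ⟨c, hc, hdiv⟩ := exists_synthetic_division α m a
    obtain ⟨s, hs, hbound⟩ := ih c (hc ▸ ham)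
    refine ⟨insert α s, (Finset.card_insert_le _ _).trans (by omega),
      fun x y δ hδ hdist I hI => ?_⟩
    have hP := hdiv ((x : ℍ) + y • I)
    rw [hα, sub_zero] at hP
    rw [hP]
    set q : ℍ := (x : ℍ) + y • I with hq
    have hqα : δ ≤ ‖q - α‖ := hdist α (Finset.mem_insert_self _ _) I hI
    by_cases h0 : q - α = 0
    · have : δ = 0 := le_antisymm (by simpa [h0] using hqα) hδ
      simp [this]
    · set h := q - α
      have hconj : h⁻¹ * q * h = (x : ℍ) + y • (h⁻¹ * I * h) := by
        rw [hq, mul_add, add_mul, ← coe_commutes, mul_assoc, inv_mul_cancel₀ h0, mul_one,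
          mul_smul_comm, smul_mul_assoc]
      have hpow : ∀ k : ℕ, q ^ k * h = h * (h⁻¹ * q * h) ^ k := fun k =>
        (SemiconjBy.pow_right (show SemiconjBy h (h⁻¹ * q * h) q by
          rw [SemiconjBy, ← mul_assoc, ← mul_assoc, mul_inv_cancel₀ h0, one_mul]) k).symm
      have hb := hbound x y δ hδ (fun β hβ => hdist β (Finset.mem_insert_of_mem hβ))
        _ (QSphere.conj_mem hI h0)
      rw [← hconj, hc] at hb
      simp only [hpow, mul_assoc h]
      rw [← Finset.mul_sum, norm_mul]
      calc ‖a (m + 1)‖ * δ ^ (m + 1) = δ * (‖a (m + 1)‖ * δ ^ m) := by ring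
        _ ≤ _ := mul_le_mul hqα hb (by positivity) (norm_nonneg _)

/-- Distances in `ℍ` from a sphere `x + y𝕊` reduce to planar distances. -/
lemma planar_norm_le_norm_sub {x y : ℝ} {J : ℍ} (hJ : J ∈ QSphere) (α : ℍ) :
    ‖(⟨x, y⟩ : ℂ) - ⟨α.re, ‖α.im‖⟩‖ ≤ ‖(x : ℍ) + y • J - α‖ ∨
      ‖(⟨x, y⟩ : ℂ) - ⟨α.re, -‖α.im‖⟩‖ ≤ ‖(x : ℍ) + y • J - α‖ := by
  have hre := QSphere.re_eq_zero hJ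
  set t := ‖α.im‖
  have hsq : ‖(x : ℍ) + y • J - α‖ ^ 2 = (x - α.re) ^ 2 + ‖y • J - α.im‖ ^ 2 := by
    simp only [pow_two ‖_‖, ← normSq_eq_norm_mul_self, normSq_def']
    simp [hre]
    ring
  have hy : ‖y • J‖ = |y| := by rw [norm_smul, QSphere.norm_eq_one hJ, mul_one, Real.norm_eq_abs]
  have habs : |(|y| - t)| ≤ ‖y • J - α.im‖ := hy ▸ abs_norm_sub_norm_le (y • J) α.im
  have hsq' : (|y| - t) ^ 2 ≤ ‖y • J - α.im‖ ^ 2 := by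
    rw [← sq_abs]; exact pow_le_pow_left₀ (abs_nonneg _) habs 2
  rcases abs_cases y with ⟨h, -⟩ | ⟨h, -⟩ <;> rw [h] at hsq'
  · left
    refine le_of_sq_le_sq ?_ (norm_nonneg _)
    rw [hsq, Complex.sq_norm, Complex.normSq_apply]
    simp only [Complex.sub_re, Complex.sub_im]
    nlinarith
  · right
    refine le_of_sq_le_sq ?_ (norm_nonneg _)
    rw [hsq, Complex.sq_norm, Complex.normSq_apply]
    simp only [Complex.sub_re, Complex.sub_im]
    nlinarith

/-- Among `N + 1` points spaced by `2δ`, one is at distance at least `δ` from `N` given points. -/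
lemma exists_odd_multiple_far {δ : ℝ} (hδ : 0 < δ) {N : ℕ} (T : Finset ℝ) (hT : T.card ≤ N) :
    ∃ k : ℕ, k ≤ N ∧ ∀ ρ ∈ T, δ ≤ |(2 * k + 1) * δ - ρ| := by
  by_contra! hcon
  choose! f hfT hf using hcon
  obtain ⟨i, hi, j, hj, hij, hfij⟩ := Finset.exists_ne_map_eq_of_card_lt_of_maps_to
    (s := Finset.range (N + 1)) (t := T) (f := f) (by rw [Finset.card_range]; omega)
    (fun k hk => hfT k (Nat.lt_succ_iff.mp (Finset.mem_range.mp hk)))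
  have h1 := abs_lt.mp (hf i (Nat.lt_succ_iff.mp (Finset.mem_range.mp hi)))
  have h2 := abs_lt.mp (hf j (Nat.lt_succ_iff.mp (Finset.mem_range.mp hj)))
  rw [hfij] at h1
  rcases lt_or_gt_of_ne hij with h | h
  · have h' : (i : ℝ) + 1 ≤ j := by exact_mod_cast h
    nlinarith
  · have h' : (j : ℝ) + 1 ≤ i := by exact_mod_cast h
    nlinarith

/-- Lower bound for a slice regular polynomial of degree `m` on a toroidal hypersurface
`Γ = {x + yI : (x−u)² + (y−v)² = r², I ∈ 𝕊}` with `0 < r < R`: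
`|P(q)| ≥ |aₘ| (R/(2(2m+1)))^m` on `Γ`. -/
theorem ehrenpreis_malgrange_torus (m : ℕ) (a : ℕ → ℍ) (ham : a m ≠ 0)
    (P : ℍ → ℍ) (hP : ∀ q : ℍ, P q = ∑ n ∈ Finset.range (m + 1), q ^ n * a n)
    (u v : ℝ) (I₀ : ℍ) (hI₀ : I₀ ∈ QSphere) (R : ℝ) (hR : 0 < R) :
    ∃ r : ℝ, 0 < r ∧ r < R ∧
      ∀ (x y : ℝ) (I : ℍ), I ∈ QSphere → (x - u) ^ 2 + (y - v) ^ 2 = r ^ 2 →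
        ‖a m‖ * (R / (2 * (2 * (m : ℝ) + 1))) ^ m ≤ ‖P ((x : ℍ) + y • I)‖ := by
  classical
  obtain ⟨s, hs, hbound⟩ := exists_finset_norm_sliceRegularPolynomial_ge m a ham
  set δ := R / (2 * (2 * (m : ℝ) + 1)) with hδ
  have hδ0 : 0 < δ := by positivity
  have hRδ : R = (2 * (2 * (m : ℝ) + 1)) * δ := by rw [hδ]; field_simp
  let w : ℂ := ⟨u, v⟩
  obtain ⟨k, hk, hfar⟩ := exists_odd_multiple_far hδ0 (N := 2 * m)
    (s.image (fun α => ‖(⟨α.re, ‖α.im‖⟩ : ℂ) - w‖) ∪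
      s.image (fun α => ‖(⟨α.re, -‖α.im‖⟩ : ℂ) - w‖))
    ((Finset.card_union_le _ _).trans (by
      have h1 := Finset.card_image_le (s := s) (f := fun α : ℍ => ‖(⟨α.re, ‖α.im‖⟩ : ℂ) - w‖)
      have h2 := Finset.card_image_le (s := s) (f := fun α : ℍ => ‖(⟨α.re, -‖α.im‖⟩ : ℂ) - w‖)
      omega))
  have hk' : (k : ℝ) ≤ 2 * m := by exact_mod_cast hk
  have hr0 : 0 < (2 * k + 1) * δ := by positivity
  refine ⟨(2 * k + 1) * δ, hr0, by nlinarith, fun x y I hI hxy => ?_⟩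
  rw [hP]
  refine hbound x y δ hδ0.le (fun α hα J hJ => ?_) I hI
  have hz : ‖(⟨x, y⟩ : ℂ) - w‖ = (2 * k + 1) * δ := by
    refine (sq_eq_sq₀ (norm_nonneg _) hr0.le).mp ?_
    rw [← hxy, Complex.sq_norm, Complex.normSq_apply]
    simp only [w, Complex.sub_re, Complex.sub_im]
    ring
  have htri : ∀ β : ℂ, |(2 * k + 1) * δ - ‖β - w‖| ≤ ‖(⟨x, y⟩ : ℂ) - β‖ := fun β => by
    have h := abs_norm_sub_norm_le ((⟨x, y⟩ : ℂ) - w) (β - w)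
    rwa [hz, sub_sub_sub_cancel_right] at h
  rcases planar_norm_le_norm_sub hJ α with h | h
  · exact (hfar _ (Finset.mem_union_left _ (Finset.mem_image_of_mem _ hα))).trans
      ((htri _).trans h)
  · exact (hfar _ (Finset.mem_union_right _ (Finset.mem_image_of_mem _ hα))).trans
      ((htri _).trans h)
end

section
/- Blaschke factor: Let a ∈ ℍ with 0 < |a| < 1. For q in the closed unit ball of ℍ, set q̃ = (1 − qa)⁻¹ q (1 − qa) (well defined since |qa| < 1) and define the Blaschke factor B_a(q) = (1 − q̃·ā)⁻¹ (a − q̃) · (ā/|a|). Then: (1) |B_a(q)| < 1 whenever |q| < 1; (2) |B_a(q)| = 1 whenever |q| = 1; (3) B_a(q) = 0 if and only if q = a, i.e. a is the unique zero of B_a in the unit ball. -/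
open Quaternion

namespace Quaternion

theorem norm_sq_one_sub_mul_star_sub_norm_sq_sub (a p : ℍ) :
    ‖1 - p * star a‖ ^ 2 - ‖a - p‖ ^ 2 = (1 - ‖a‖ ^ 2) * (1 - ‖p‖ ^ 2) := by
  simp only [sq, ← normSq_eq_norm_mul_self, normSq_def']
  simp
  ring

theorem one_sub_mul_ne_zero {p b : ℍ} (hp : ‖p‖ ≤ 1) (hb : ‖b‖ < 1) : 1 - p * b ≠ 0 := by
  intro h
  have h1 : ‖p * b‖ = 1 := by rw [← sub_eq_zero.mp h, norm_one]
  rw [norm_mul] at h1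
  nlinarith [norm_nonneg p, norm_nonneg b]

theorem norm_inv_mul_mul_cancel {u : ℍ} (hu : u ≠ 0) (q : ℍ) : ‖u⁻¹ * q * u‖ = ‖q‖ := by
  have : ‖u‖ ≠ 0 := norm_ne_zero_iff.mpr hu
  rw [norm_mul, norm_mul, norm_inv]
  field_simp

/-- The twisted point `(1 - qa)⁻¹ q (1 - qa)` equals `a` only when `q` does. -/
theorem inv_one_sub_mul_mul_eq_iff {a q : ℍ} (hq : ‖q‖ ≤ 1) (ha : ‖a‖ < 1) :
    (1 - q * a)⁻¹ * q * (1 - q * a) = a ↔ q = a := by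
  have hu := one_sub_mul_ne_zero hq ha
  rw [mul_assoc, inv_mul_eq_iff_eq_mul₀ hu]
  constructor
  · intro h
    have h1 : q - a = q * (q - a) * a := by
      rw [← sub_eq_zero] at h ⊢
      rw [← h]
      noncomm_ring
    by_contra hne
    have hpos : 0 < ‖q - a‖ := norm_pos_iff.mpr (sub_ne_zero.mpr hne)
    have h2 := congrArg norm h1
    rw [norm_mul, norm_mul] at h2
    nlinarith [mul_nonneg (sub_nonneg.mpr hq) (mul_nonneg hpos.le (norm_nonneg a)),
      mul_pos hpos (sub_pos.mpr ha)]
  · rintro rfl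
    noncomm_ring

end Quaternion

/-- **Blaschke factor.** For `a ∈ ℍ` with `0 < |a| < 1` and
`B_a(q) = (1 − q̃ā)⁻¹ (a − q̃)(ā/|a|)` with `q̃ = (1 − qa)⁻¹ q (1 − qa)`:
it maps the open unit ball into itself, the unit sphere to itself, and its unique
zero in the closed unit ball is `q = a`. -/
theorem blaschke_factor (a : ℍ) (ha0 : 0 < ‖a‖) (ha1 : ‖a‖ < 1)
    (B : ℍ → ℍ)
    (hB : ∀ q : ℍ, ‖q‖ ≤ 1 →
      B q = (1 - ((1 - q * a)⁻¹ * q * (1 - q * a)) * star a)⁻¹ *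
              (a - (1 - q * a)⁻¹ * q * (1 - q * a)) * (‖a‖⁻¹ • star a)) :
    (∀ q : ℍ, ‖q‖ < 1 → ‖B q‖ < 1) ∧
      (∀ q : ℍ, ‖q‖ = 1 → ‖B q‖ = 1) ∧
      ∀ q : ℍ, ‖q‖ ≤ 1 → (B q = 0 ↔ q = a) := by
  have hunit : ‖‖a‖⁻¹ • star a‖ = 1 := by
    rw [norm_smul, norm_star, norm_inv, norm_norm, inv_mul_cancel₀ ha0.ne']
  have hnorm : ∀ q : ℍ, ‖q‖ ≤ 1 → ∃ x y : ℝ, 0 < x ∧ 0 ≤ y ∧ ‖B q‖ = y / x ∧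
      x ^ 2 - y ^ 2 = (1 - ‖a‖ ^ 2) * (1 - ‖q‖ ^ 2) ∧ (y = 0 ↔ q = a) := by
    intro q hq
    have hp := norm_inv_mul_mul_cancel (one_sub_mul_ne_zero hq ha1) q
    have hiff := inv_one_sub_mul_mul_eq_iff hq ha1
    rw [hB q hq]
    generalize (1 - q * a)⁻¹ * q * (1 - q * a) = p at hp hiff ⊢
    refine ⟨‖1 - p * star a‖, ‖a - p‖, ?_, norm_nonneg _, ?_, ?_, ?_⟩
    · exact norm_pos_iff.mpr (one_sub_mul_ne_zero (hp.trans_le hq) (by rwa [norm_star]))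
    · rw [norm_mul, norm_mul, hunit, norm_inv, mul_one, inv_mul_eq_div]
    · rw [norm_sq_one_sub_mul_star_sub_norm_sq_sub, hp]
    · rw [norm_eq_zero, sub_eq_zero, eq_comm, hiff]
  refine ⟨fun q hq => ?_, fun q hq => ?_, fun q hq => ?_⟩
  · obtain ⟨x, y, hx, hy, hBq, hxy, -⟩ := hnorm q hq.le
    rw [hBq, div_lt_one hx]
    refine lt_of_pow_lt_pow_left₀ 2 hx.le (sub_pos.mp ?_)
    rw [hxy]
    exact mul_pos (sub_pos.mpr (pow_lt_one₀ (norm_nonneg _) ha1 two_ne_zero))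
      (sub_pos.mpr (pow_lt_one₀ (norm_nonneg _) hq two_ne_zero))
  · obtain ⟨x, y, hx, hy, hBq, hxy, -⟩ := hnorm q hq.le
    rw [hq, one_pow, sub_self, mul_zero, sub_eq_zero] at hxy
    rw [hBq, div_eq_one_iff_eq hx.ne']
    exact ((pow_left_inj₀ hx.le hy two_ne_zero).mp hxy).symm
  · obtain ⟨x, y, hx, -, hBq, -, hy⟩ := hnorm q hq
    rw [← hy, ← norm_eq_zero, hBq, div_eq_zero_iff, or_iff_left hx.ne']
end

section
/- Order of an entire slice regular function via its Taylor coefficients: Let f(q) = Σ_{n=0}^∞ qⁿaₙ (aₙ ∈ ℍ, limsup_n |aₙ|^{1/n} = 0) be an entire slice regular function of finite order ρ, where ρ = limsup_{r→∞} log(log M_f(r)) / log r and M_f(r) = max_{|q|=r} |f(q)|. Then ρ = limsup_{n→∞} (n·log n) / log(1/|aₙ|); moreover, if 0 < ρ < ∞ and σ is the type of f, i.e. σ = limsup_{r→∞} log M_f(r) / r^ρ, then (σ·e·ρ)^{1/ρ} = limsup_{n→∞} n^{1/ρ}·|aₙ|^{1/n}. -/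
open Quaternion
open scoped InnerProductSpace

open Filter

lemma sInf_le_sInf_of_dense {S T : Set ℝ} (hT : ∀ s ∈ T, 0 ≤ s)
    (hST : ∀ s ∈ S, ∀ t, s < t → t ∈ T) : S.Nonempty → sInf T ≤ sInf S := by
  intro hne
  refine le_csInf hne fun s hs => le_of_forall_gt_imp_ge_of_dense fun t h => ?_
  exact csInf_le ⟨0, hT⟩ (hST s hs t h)

/-- Two eventually nonnegative functions with the same eventual upper bounds up to an arbitrarily
small loss have the same real `limsup`, including when they are unbounded. -/
lemma limsup_eq_limsup_of_bounds {α β : Type*} {F : Filter α} {G : Filter β} [F.NeBot] [G.NeBot]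
    {u : α → ℝ} {v : β → ℝ} (hu : ∀ᶠ x in F, 0 ≤ u x) (hv : ∀ᶠ y in G, 0 ≤ v y)
    (huv : ∀ s, 0 < s → (∀ᶠ x in F, u x ≤ s) → ∀ s', s < s' → ∀ᶠ y in G, v y ≤ s')
    (hvu : ∀ s, 0 < s → (∀ᶠ y in G, v y ≤ s) → ∀ s', s < s' → ∀ᶠ x in F, u x ≤ s') :
    limsup u F = limsup v G := by
  rw [limsup_eq, limsup_eq]
  have hS : ∀ s ∈ {s | ∀ᶠ x in F, u x ≤ s}, 0 ≤ s := fun s hs => by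
    obtain ⟨x, h1, h2⟩ := (hu.and hs).exists
    exact h1.trans h2
  have hT : ∀ s ∈ {s | ∀ᶠ y in G, v y ≤ s}, 0 ≤ s := fun s hs => by
    obtain ⟨x, h1, h2⟩ := (hv.and hs).exists
    exact h1.trans h2
  have hST : ∀ s ∈ {s | ∀ᶠ x in F, u x ≤ s}, ∀ s', s < s' → s' ∈ {s | ∀ᶠ y in G, v y ≤ s} := by
    intro s hs s' h
    have := hS s hs
    exact huv ((s + s') / 2) (by linarith)
      (hs.mono fun x hx => by linarith) s' (by linarith)
  have hTS : ∀ s ∈ {s | ∀ᶠ y in G, v y ≤ s}, ∀ s', s < s' → s' ∈ {s | ∀ᶠ x in F, u x ≤ s} := by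
    intro s hs s' h
    have := hT s hs
    exact hvu ((s + s') / 2) (by linarith)
      (hs.mono fun x hx => by linarith) s' (by linarith)
  rcases Set.eq_empty_or_nonempty {s | ∀ᶠ x in F, u x ≤ s} with h | h
  · rcases Set.eq_empty_or_nonempty {s | ∀ᶠ y in G, v y ≤ s} with h' | ⟨s, h'⟩
    · rw [h, h']
    · exact absurd (hTS s h' (s + 1) (by linarith)) (by rw [h]; simp)
  · have h' : {s | ∀ᶠ y in G, v y ≤ s}.Nonempty :=
      ⟨h.some + 1, hST _ h.some_mem _ (by linarith)⟩
    exact le_antisymm (sInf_le_sInf_of_dense hS hTS h') (sInf_le_sInf_of_dense hT hST h)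

lemma mul_exp_one_rpow_le {k x : ℝ} (hk : 0 < k) (hx : 0 < x) (n : ℕ) :
    (Real.exp 1 * k * x / n) ^ ((n : ℝ) / k) ≤ Real.exp x := by
  rcases Nat.eq_zero_or_pos n with rfl | hn
  · simpa using hx.le
  have hn' : (0 : ℝ) < n := by exact_mod_cast hn
  have h : Real.exp 1 * k * x / n ≤ Real.exp (k * x / n) := by
    have h1 := Real.add_one_le_exp (k * x / n - 1)
    have h2 : Real.exp (k * x / n) = Real.exp 1 * Real.exp (k * x / n - 1) := by
      rw [← Real.exp_add]; ring_nf
    rw [h2, mul_assoc, mul_div_assoc]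
    gcongr
    linarith
  calc _ ≤ Real.exp (k * x / n) ^ ((n : ℝ) / k) := by gcongr
    _ = Real.exp x := by
      rw [← Real.exp_mul]
      congr 1
      field_simp

/-- A growth bound `M r ≤ exp (A r ^ k)` bounds the coefficients. -/
lemma coeff_le_of_growth {c : ℕ → ℝ} {M : ℝ → ℝ} (hlow : ∀ n r, 0 < r → c n * r ^ n ≤ M r)
    {k A : ℝ} (hk : 0 < k) (hA : 0 < A) (h : ∀ᶠ r in atTop, M r ≤ Real.exp (A * r ^ k)) :
    ∀ᶠ n : ℕ in atTop, c n ≤ (Real.exp 1 * k * A / n) ^ ((n : ℝ) / k) := by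
  have hr : Tendsto (fun n : ℕ => ((n : ℝ) / (k * A)) ^ (1 / k)) atTop atTop :=
    (tendsto_rpow_atTop (by positivity)).comp
      (tendsto_natCast_atTop_atTop.atTop_div_const (by positivity))
  filter_upwards [hr.eventually h, eventually_gt_atTop 0] with n hn hn0
  have hn' : (0 : ℝ) < n := by exact_mod_cast hn0
  set b : ℝ := (n : ℝ) / (k * A) with hb
  have hb0 : 0 < b := by positivity
  have h1 := (hlow n (b ^ (1 / k)) (by positivity)).trans hn
  rw [← Real.rpow_mul hb0.le, one_div_mul_cancel hk.ne', Real.rpow_one,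
    ← Real.rpow_natCast, ← Real.rpow_mul hb0.le, one_div_mul_eq_div] at h1
  have h2 : Real.exp (A * b) = Real.exp 1 ^ ((n : ℝ) / k) := by
    rw [← Real.exp_mul, hb]
    congr 1
    field_simp
  have h3 : Real.exp 1 * k * A / n = Real.exp 1 / b := by
    rw [hb]; field_simp
  rw [h3, Real.div_rpow (by positivity) hb0.le, le_div_iff₀ (by positivity), ← h2]
  exact h1

/-- Coefficient bounds control the growth of a function dominated by the power series. -/
lemma growth_le_of_coeff {c : ℕ → ℝ} (hc : ∀ n, 0 ≤ c n) {M : ℝ → ℝ}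
    (hup : ∀ r, 0 < r → M r ≤ ∑' n, c n * r ^ n) {k A A' : ℝ} (hk : 0 < k) (hA : 0 < A)
    (hAA' : A < A')
    (h : ∀ᶠ n : ℕ in atTop, c n ≤ (Real.exp 1 * k * A / n) ^ ((n : ℝ) / k)) :
    ∀ᶠ r in atTop, M r ≤ Real.exp (A' * r ^ k) := by
  obtain ⟨B, hAB, hBA'⟩ := exists_between hAA'
  have hB : 0 < B := hA.trans hAB
  set θ : ℝ := (A / B) ^ (1 / k) with hθ
  have hθ0 : 0 < θ := by positivity
  have hθ1 : θ < 1 :=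
    Real.rpow_lt_one (by positivity) ((div_lt_one hB).2 hAB) (by positivity)
  set g : ℕ → ℝ := fun n => θ ^ n * (Real.exp 1 * k * B / n) ^ ((n : ℝ) / k) with hg
  have hg0 : ∀ n, 0 < g n := by
    intro n
    rcases Nat.eq_zero_or_pos n with rfl | hn
    · simp [hg]
    · have : (0 : ℝ) < n := by exact_mod_cast hn
      positivity
  have hcg : c =O[atTop] g := by
    refine Asymptotics.IsBigO.of_bound 1 ?_
    filter_upwards [h] with n hn
    rw [Real.norm_of_nonneg (hc n), Real.norm_of_nonneg (hg0 n).le, one_mul]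
    refine hn.trans (le_of_eq ?_)
    rw [hg, hθ]
    simp only
    rw [← Real.rpow_natCast, ← Real.rpow_mul (by positivity), one_div_mul_eq_div,
      ← Real.mul_rpow (by positivity) (by positivity)]
    congr 1
    field_simp
  obtain ⟨C, hC0, hC⟩ := Asymptotics.bound_of_isBigO_nat_atTop hcg
  have hterm : ∀ r, 0 < r → ∀ n, c n * r ^ n ≤ C * Real.exp (B * r ^ k) * θ ^ n := by
    intro r hr n
    have h1 := hC (hg0 n).ne'
    rw [Real.norm_of_nonneg (hc n), Real.norm_of_nonneg (hg0 n).le] at h1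
    have h2 : (Real.exp 1 * k * B / n) ^ ((n : ℝ) / k) * r ^ n ≤ Real.exp (B * r ^ k) := by
      refine le_trans (le_of_eq ?_) (mul_exp_one_rpow_le hk (by positivity) n)
      have : r ^ n = (r ^ k) ^ ((n : ℝ) / k) := by
        rw [← Real.rpow_mul hr.le, mul_div_cancel₀ _ hk.ne', Real.rpow_natCast]
      rw [this, ← Real.mul_rpow (by positivity) (by positivity)]
      congr 1
      ring
    calc c n * r ^ n ≤ C * g n * r ^ n := by gcongr
      _ = C * θ ^ n * ((Real.exp 1 * k * B / n) ^ ((n : ℝ) / k) * r ^ n) := by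
        simp only [hg]; ring
      _ ≤ C * θ ^ n * Real.exp (B * r ^ k) := by gcongr
      _ = _ := by ring
  have hlim : Tendsto (fun r : ℝ => (A' - B) * r ^ k) atTop atTop :=
    (tendsto_rpow_atTop hk).const_mul_atTop (by linarith)
  filter_upwards [eventually_gt_atTop 0,
    (Real.tendsto_exp_atTop.comp hlim).eventually_ge_atTop (C * (1 - θ)⁻¹)] with r hr hr'
  have hgeo := (hasSum_geometric_of_lt_one hθ0.le hθ1).mul_left (C * Real.exp (B * r ^ k))
  have hs : Summable fun n => c n * r ^ n :=
    hgeo.summable.of_nonneg_of_le (fun n => mul_nonneg (hc n) (by positivity)) (hterm r hr)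
  calc M r ≤ ∑' n, c n * r ^ n := hup r hr
    _ ≤ C * Real.exp (B * r ^ k) * (1 - θ)⁻¹ := hasSum_le (hterm r hr) hs.hasSum hgeo
    _ = C * (1 - θ)⁻¹ * Real.exp (B * r ^ k) := by ring
    _ ≤ Real.exp ((A' - B) * r ^ k) * Real.exp (B * r ^ k) := by gcongr; exact hr'
    _ = Real.exp (A' * r ^ k) := by rw [← Real.exp_add]; ring_nf

lemma tendsto_atTop_of_coeff_pos {c : ℕ → ℝ} {M : ℝ → ℝ}
    (hlow : ∀ n r, 0 < r → c n * r ^ n ≤ M r) {N : ℕ} (hN : N ≠ 0) (hcN : 0 < c N) :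
    Tendsto M atTop atTop := by
  refine tendsto_atTop_mono' _ ?_ ((tendsto_pow_atTop hN).const_mul_atTop hcN)
  filter_upwards [eventually_gt_atTop 0] with r hr using hlow N r hr

lemma limsup_order_eq {c : ℕ → ℝ} (hc : ∀ n, 0 ≤ c n) {M : ℝ → ℝ}
    (hlow : ∀ n r, 0 < r → c n * r ^ n ≤ M r) (hup : ∀ r, 0 < r → M r ≤ ∑' n, c n * r ^ n)
    (hM : Tendsto M atTop atTop) (hc1 : ∀ᶠ n in atTop, c n < 1) :
    limsup (fun r : ℝ => Real.log (Real.log (M r)) / Real.log r) atTop =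
      limsup (fun n : ℕ => ((n : ℝ) * Real.log n) / Real.log (1 / c n)) atTop := by
  have hlogM : Tendsto (fun r => Real.log (M r)) atTop atTop := Real.tendsto_log_atTop.comp hM
  have hlogn : Tendsto (fun n : ℕ => Real.log n) atTop atTop :=
    Real.tendsto_log_atTop.comp tendsto_natCast_atTop_atTop
  have hlogc : ∀ n, 0 < c n → c n < 1 → 0 < Real.log (1 / c n) := fun n h0 h1 =>
    Real.log_pos ((one_lt_div h0).2 h1)
  refine limsup_eq_limsup_of_bounds ?_ ?_ ?_ ?_
  · filter_upwards [hlogM.eventually_ge_atTop 1, eventually_ge_atTop 1] with r h1 h2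
    exact div_nonneg (Real.log_nonneg h1) (Real.log_nonneg h2)
  · filter_upwards [hc1, eventually_ge_atTop 1] with n h1 h2
    rcases (hc n).eq_or_lt with h | h
    · simp [← h]
    · exact div_nonneg (mul_nonneg (by positivity) (Real.log_natCast_nonneg n)) (hlogc n h h1).le
  · intro s hs h s' hss'
    have hM' : ∀ᶠ r in atTop, M r ≤ Real.exp (1 * r ^ s) := by
      filter_upwards [h, hlogM.eventually_gt_atTop 0, hM.eventually_gt_atTop 0,
        eventually_gt_atTop 1] with r h1 h2 h3 h4
      rw [div_le_iff₀ (Real.log_pos h4)] at h1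
      rw [one_mul, ← Real.log_le_iff_le_exp h3, Real.rpow_def_of_pos (by linarith),
        ← Real.log_le_iff_le_exp h2]
      linarith
    filter_upwards [coeff_le_of_growth hlow hs one_pos hM', hc1, eventually_gt_atTop 0,
      (hlogn.const_mul_atTop (sub_pos.2 hss')).eventually_ge_atTop
        (s' * Real.log (Real.exp 1 * s))] with n h1 h2 h3 h4
    have hn : (0 : ℝ) < n := by exact_mod_cast h3
    rcases (hc n).eq_or_lt with h0 | h0
    · simpa [← h0] using (hs.trans hss').le
    rw [div_le_iff₀ (hlogc n h0 h2), one_div, Real.log_inv]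
    have h5 := Real.log_le_log h0 h1
    rw [Real.log_rpow (by positivity), mul_one, Real.log_div (by positivity) hn.ne'] at h5
    have h6 : s' * (n / s * (Real.log n - Real.log (Real.exp 1 * s))) ≤ s' * -Real.log (c n) := by
      apply mul_le_mul_of_nonneg_left _ (by linarith)
      linarith
    refine le_trans ?_ h6
    have h7 : s' * (n / s * (Real.log n - Real.log (Real.exp 1 * s))) =
        n / s * (s' * (Real.log n - Real.log (Real.exp 1 * s))) := by ring
    have h8 : n * Real.log n = n / s * (s * Real.log n) := by field_simp
    rw [h7, h8]
    exact mul_le_mul_of_nonneg_left (by linarith) (by positivity)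
  · intro s hs h s' hss'
    have hA : 0 < 1 / (Real.exp 1 * s) := by positivity
    have hc' : ∀ᶠ n : ℕ in atTop,
        c n ≤ (Real.exp 1 * s * (1 / (Real.exp 1 * s)) / n) ^ ((n : ℝ) / s) := by
      filter_upwards [h, hc1, eventually_gt_atTop 0] with n h1 h2 h3
      have hn : (0 : ℝ) < n := by exact_mod_cast h3
      rcases (hc n).eq_or_lt with h0 | h0
      · rw [← h0]; positivity
      rw [div_le_iff₀ (hlogc n h0 h2), one_div, Real.log_inv] at h1
      rw [mul_one_div_cancel (by positivity), ← Real.log_le_log_iff h0 (by positivity),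
        Real.log_rpow (by positivity), one_div, Real.log_inv, div_mul_eq_mul_div, le_div_iff₀ hs]
      linarith
    filter_upwards [growth_le_of_coeff hc hup hs hA (lt_add_one _) hc',
      hlogM.eventually_gt_atTop 0, hM.eventually_gt_atTop 0, eventually_gt_atTop 1,
      (Real.tendsto_log_atTop.const_mul_atTop (sub_pos.2 hss')).eventually_ge_atTop
        (Real.log (1 / (Real.exp 1 * s) + 1))] with r h1 h2 h3 h4 h5
    rw [← Real.log_le_iff_le_exp h3] at h1
    have hr : 0 < r := by linarith
    have h6 := Real.log_le_log h2 h1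
    rw [Real.log_mul (by positivity) (by positivity), Real.log_rpow hr] at h6
    rw [div_le_iff₀ (Real.log_pos h4)]
    linarith

lemma limsup_mul_rpow {v : ℕ → ℝ} (hv : ∀ n, 0 ≤ v n) {b p : ℝ} (hb : 0 < b) (hp : 0 < p) :
    limsup (fun n => (v n * b) ^ p) atTop = (limsup v atTop * b) ^ p := by
  have hcobdd : IsCoboundedUnder (· ≤ ·) atTop v :=
    (isBoundedUnder_of ⟨0, hv⟩ : IsBoundedUnder (· ≥ ·) atTop v).isCoboundedUnder_le
  by_cases hbdd : IsBoundedUnder (· ≤ ·) atTop v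
  · have h0 : 0 ≤ limsup v atTop :=
      le_limsup_of_frequently_le (Frequently.of_forall hv) hbdd
    have hmono : Monotone fun x : ℝ => (max x 0 * b) ^ p := by
      intro x y hxy
      simp only
      gcongr
    have hcont : Continuous fun x : ℝ => (max x 0 * b) ^ p :=
      ((continuous_id.max continuous_const).mul continuous_const).rpow_const
        fun _ => Or.inr hp.le
    have := hmono.map_limsup_of_continuousAt v hcont.continuousAt hbdd hcobdd
    simp only [Function.comp_def, max_eq_left h0, max_eq_left (hv _)] at this
    exact this.symm
  · have hbdd' : ¬ IsBoundedUnder (· ≤ ·) atTop fun n => (v n * b) ^ p := by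
      rintro ⟨C, hC⟩
      refine hbdd ⟨C ^ p⁻¹ / b, ?_⟩
      rw [eventually_map] at hC ⊢
      filter_upwards [hC] with n hn
      rw [le_div_iff₀ hb]
      have h1 : 0 ≤ v n * b := mul_nonneg (hv n) hb.le
      rwa [Real.le_rpow_inv_iff_of_pos h1 ((Real.rpow_nonneg h1 p).trans hn) hp]
    rw [limsup_eq, limsup_eq]
    have e1 : {a | ∀ᶠ n in atTop, (v n * b) ^ p ≤ a} = ∅ :=
      Set.eq_empty_iff_forall_notMem.2 fun a ha => hbdd' ⟨a, ha⟩
    have e2 : {a | ∀ᶠ n in atTop, v n ≤ a} = ∅ :=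
      Set.eq_empty_iff_forall_notMem.2 fun a ha => hbdd ⟨a, ha⟩
    rw [e1, e2, Real.sInf_empty, zero_mul, Real.zero_rpow hp.ne']

lemma limsup_type_eq {c : ℕ → ℝ} (hc : ∀ n, 0 ≤ c n) {M : ℝ → ℝ}
    (hlow : ∀ n r, 0 < r → c n * r ^ n ≤ M r) (hup : ∀ r, 0 < r → M r ≤ ∑' n, c n * r ^ n)
    (hM : Tendsto M atTop atTop) {ρ : ℝ} (hρ : 0 < ρ) :
    (limsup (fun r : ℝ => Real.log (M r) / r ^ ρ) atTop * Real.exp 1 * ρ) ^ (1 / ρ) =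
      limsup (fun n : ℕ => (n : ℝ) ^ (1 / ρ) * c n ^ (1 / (n : ℝ))) atTop := by
  have hb : 0 < Real.exp 1 * ρ := by positivity
  set v : ℕ → ℝ := fun n => n * c n ^ (ρ / n) / (Real.exp 1 * ρ) with hv
  have hv0 : ∀ n, 0 ≤ v n := fun n =>
    div_nonneg (mul_nonneg (by positivity) (Real.rpow_nonneg (hc n) _)) hb.le
  have hvw : (fun n : ℕ => (n : ℝ) ^ (1 / ρ) * c n ^ (1 / (n : ℝ))) =
      fun n => (v n * (Real.exp 1 * ρ)) ^ (1 / ρ) := by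
    funext n
    rw [hv]
    simp only
    rw [div_mul_cancel₀ _ hb.ne', Real.mul_rpow (by positivity) (Real.rpow_nonneg (hc n) _),
      ← Real.rpow_mul (hc n)]
    congr 2
    field_simp
  have hiff : ∀ n : ℕ, 0 < n → ∀ s, 0 < s →
      (v n ≤ s ↔ c n ≤ (Real.exp 1 * ρ * s / n) ^ ((n : ℝ) / ρ)) := by
    intro n hn s hs
    have hn' : (0 : ℝ) < n := by exact_mod_cast hn
    rw [← Real.rpow_inv_le_iff_of_pos (hc n) (by positivity) (by positivity), inv_div, hv]
    simp only
    rw [div_le_iff₀ hb, le_div_iff₀ hn', mul_comm (n : ℝ), mul_comm s]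
  have key : limsup (fun r : ℝ => Real.log (M r) / r ^ ρ) atTop = limsup v atTop := by
    refine limsup_eq_limsup_of_bounds ?_ (Eventually.of_forall hv0) ?_ ?_
    · filter_upwards [hM.eventually_ge_atTop 1, eventually_gt_atTop 0] with r h1 h2
      exact div_nonneg (Real.log_nonneg h1) (by positivity)
    · intro s hs h s' hss'
      have hM' : ∀ᶠ r in atTop, M r ≤ Real.exp (s * r ^ ρ) := by
        filter_upwards [h, hM.eventually_gt_atTop 0, eventually_gt_atTop 0] with r h1 h2 h3
        rwa [div_le_iff₀ (by positivity), Real.log_le_iff_le_exp h2] at h1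
      filter_upwards [coeff_le_of_growth hlow hρ hs hM', eventually_gt_atTop 0] with n h1 h2
      exact ((hiff n h2 s hs).2 h1).trans hss'.le
    · intro s hs h s' hss'
      have hc' : ∀ᶠ n : ℕ in atTop, c n ≤ (Real.exp 1 * ρ * s / n) ^ ((n : ℝ) / ρ) := by
        filter_upwards [h, eventually_gt_atTop 0] with n h1 h2
        exact (hiff n h2 s hs).1 h1
      filter_upwards [growth_le_of_coeff hc hup hρ hs hss' hc', hM.eventually_gt_atTop 0,
        eventually_gt_atTop 0] with r h1 h2 h3
      rwa [div_le_iff₀ (by positivity), Real.log_le_iff_le_exp h2]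
  rw [hvw, limsup_mul_rpow hv0 hb (by positivity), key, mul_assoc]

/-- **Cauchy's estimate** for the coefficients of an everywhere convergent vector-valued power
series. -/
lemma norm_coeff_mul_pow_le {E : Type*} [NormedAddCommGroup E] [NormedSpace ℂ E] [CompleteSpace E]
    {a : ℕ → E} {F : ℂ → E} (hs : ∀ r : NNReal, Summable fun n => ‖a n‖ * (r : ℝ) ^ n)
    (hF : ∀ z : ℂ, HasSum (fun n => z ^ n • a n) (F z)) {r C : ℝ} (hr : 0 < r)
    (hC : ∀ z : ℂ, ‖z‖ = r → ‖F z‖ ≤ C) (n : ℕ) : ‖a n‖ * r ^ n ≤ C := by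
  set p : FormalMultilinearSeries ℂ ℂ E :=
    fun n => ContinuousMultilinearMap.mkPiRing ℂ (Fin n) (a n) with hp
  have hball : HasFPowerSeriesOnBall F p 0 ⊤ := by
    refine ⟨?_, by simp, fun {y} _ => ?_⟩
    · rw [p.radius_eq_top_of_summable_norm]
      simpa [hp] using hs
    · simpa [hp] using hF y
  have hd : Differentiable ℂ F := fun z =>
    (hball.analyticAt_of_mem (by simp)).differentiableAt
  have h1 := Complex.norm_iteratedDeriv_le_of_forall_mem_sphere_norm_le (c := 0) n hr
    hd.diffContOnCl (C := C) (fun z hz => hC z (by simpa using hz))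
  have h2 := hball.factorial_smul (1 : ℂ) n
  rw [← iteratedDeriv_eq_iteratedFDeriv] at h2
  rw [← h2] at h1
  simp only [hp, ContinuousMultilinearMap.mkPiRing_apply, Finset.prod_const_one, one_smul,
    ← Nat.cast_smul_eq_nsmul ℂ, norm_smul, Complex.norm_natCast] at h1
  rw [mul_div_assoc] at h1
  have h3 := le_of_mul_le_mul_left h1 (by positivity)
  rwa [le_div_iff₀ (by positivity)] at h3


lemma quaternion_summable_norm_coeff {f : ℍ → ℍ} {a : ℕ → ℍ}
    (hsum : ∀ q : ℍ, HasSum (fun n : ℕ => q ^ n * a n) (f q)) {r : ℝ} (hr : 0 ≤ r) :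
    Summable fun n => ‖a n‖ * r ^ n := by
  have := (hsum (r : ℍ)).summable.norm
  simpa [norm_mul, norm_pow, abs_of_nonneg hr, mul_comm] using this

lemma quaternion_norm_coeff_mul_pow_le {f : ℍ → ℍ} {a : ℕ → ℍ}
    (hsum : ∀ q : ℍ, HasSum (fun n : ℕ => q ^ n * a n) (f q)) {r C : ℝ} (hr : 0 < r)
    (hC : ∀ q : ℍ, ‖q‖ = r → ‖f q‖ ≤ C) (n : ℕ) : ‖a n‖ * r ^ n ≤ C := by
  have hnorm : ∀ z : ℂ, ‖ofComplex z‖ = ‖z‖ := fun z => by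
    rw [coe_ofComplex, ← sq_eq_sq₀ (norm_nonneg _) (norm_nonneg _), sq, ← normSq_eq_norm_mul_self,
      Complex.sq_norm, Complex.normSq_apply, normSq_def']
    simp [sq]
  let _ : Module ℂ ℍ := Module.compHom ℍ ofComplex.toRingHom
  let _ : NormedSpace ℂ ℍ := ⟨fun z q => by
    change ‖ofComplex z * q‖ ≤ _
    rw [norm_mul, hnorm]⟩
  refine norm_coeff_mul_pow_le (F := fun z => f (ofComplex z))
    (fun r => quaternion_summable_norm_coeff hsum r.2) (fun z => ?_) hr
    (fun z hz => hC _ (by rw [hnorm, hz])) n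
  have := hsum (ofComplex z)
  simp only [← map_pow] at this
  exact this

/-- The maximum of `‖f‖` on a sphere lies between each term and the sum of the majorant series. -/
lemma quaternion_max_norm_bounds {f : ℍ → ℍ} {a : ℕ → ℍ}
    (hsum : ∀ q : ℍ, HasSum (fun n : ℕ => q ^ n * a n) (f q)) {r : ℝ} (hr : 0 < r) :
    (∀ n, ‖a n‖ * r ^ n ≤ sSup ((fun q : ℍ => ‖f q‖) '' {q : ℍ | ‖q‖ = r})) ∧
      sSup ((fun q : ℍ => ‖f q‖) '' {q : ℍ | ‖q‖ = r}) ≤ ∑' n, ‖a n‖ * r ^ n := by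
  have hle : ∀ x ∈ (fun q : ℍ => ‖f q‖) '' {q : ℍ | ‖q‖ = r}, x ≤ ∑' n, ‖a n‖ * r ^ n := by
    rintro x ⟨q, hq, rfl⟩
    have hq' : ‖q‖ = r := hq
    simp only
    rw [← (hsum q).tsum_eq]
    exact tsum_of_norm_bounded (quaternion_summable_norm_coeff hsum hr.le).hasSum
      fun n => by rw [norm_mul, norm_pow, hq', mul_comm]
  refine ⟨quaternion_norm_coeff_mul_pow_le hsum hr fun q hq => le_csSup ⟨_, hle⟩ ⟨q, hq, rfl⟩, ?_⟩
  refine csSup_le ⟨_, (r : ℍ), ?_, rfl⟩ hle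
  simp [abs_of_pos hr]

/-- **Order and type of an entire slice regular function via its Taylor coefficients.**
If `f(q) = Σ qⁿaₙ` is entire slice regular of finite order
`ρ = limsup_{r→∞} log log M_f(r) / log r`, then
`ρ = limsup_{n→∞} (n log n)/log(1/|aₙ|)`; and if `0 < ρ` and
`σ = limsup_{r→∞} log M_f(r)/r^ρ` is the type, then
`(σ e ρ)^{1/ρ} = limsup_{n→∞} n^{1/ρ} |aₙ|^{1/n}`. -/
theorem order_and_type_via_coefficients (f : ℍ → ℍ) (a : ℕ → ℍ)
    (hreg : SliceRegularOn f Set.univ)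
    (hsum : ∀ q : ℍ, HasSum (fun n : ℕ => q ^ n * a n) (f q))
    (hcoeff : Filter.Tendsto (fun n : ℕ => ‖a n‖ ^ (1 / (n : ℝ))) Filter.atTop (nhds 0))
    (M : ℝ → ℝ)
    (hM : ∀ r : ℝ, M r = sSup ((fun q : ℍ => ‖f q‖) '' {q : ℍ | ‖q‖ = r}))
    (ρ : ℝ)
    (hfinite : ∃ k : ℝ, 0 < k ∧ ∀ᶠ r : ℝ in Filter.atTop, M r < Real.exp (r ^ k))
    (hρ : ρ = Filter.limsup
      (fun r : ℝ => Real.log (Real.log (M r)) / Real.log r) Filter.atTop) :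
    ρ = Filter.limsup
        (fun n : ℕ => ((n : ℝ) * Real.log n) / Real.log (1 / ‖a n‖)) Filter.atTop ∧
      ∀ σ : ℝ, 0 < ρ →
        σ = Filter.limsup (fun r : ℝ => Real.log (M r) / r ^ ρ) Filter.atTop →
        (σ * Real.exp 1 * ρ) ^ (1 / ρ) =
          Filter.limsup
            (fun n : ℕ => (n : ℝ) ^ (1 / ρ) * ‖a n‖ ^ (1 / (n : ℝ))) Filter.atTop := by
  have hlow : ∀ n r, 0 < r → ‖a n‖ * r ^ n ≤ M r := fun n r hr =>
    hM r ▸ (quaternion_max_norm_bounds hsum hr).1 n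
  have hup : ∀ r, 0 < r → M r ≤ ∑' n, ‖a n‖ * r ^ n := fun r hr =>
    hM r ▸ (quaternion_max_norm_bounds hsum hr).2
  have hc : ∀ n, 0 ≤ ‖a n‖ := fun n => norm_nonneg _
  by_cases hN : ∃ N, N ≠ 0 ∧ a N ≠ 0
  · obtain ⟨N, hN, haN⟩ := hN
    have hMtop : Tendsto M atTop atTop :=
      tendsto_atTop_of_coeff_pos hlow hN (norm_pos_iff.2 haN)
    have hc1 : ∀ᶠ n in atTop, ‖a n‖ < 1 := by
      filter_upwards [hcoeff.eventually_lt_const one_pos, eventually_gt_atTop 0] with n h1 h2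
      by_contra! h
      exact absurd (Real.one_le_rpow h (by positivity)) h1.not_ge
    refine ⟨hρ.trans (limsup_order_eq hc hlow hup hMtop hc1), ?_⟩
    rintro σ hρ0 rfl
    exact limsup_type_eq hc hlow hup hMtop hρ0
  · push Not at hN
    have hconst : ∀ r, 0 < r → M r = ‖a 0‖ := by
      intro r hr
      refine le_antisymm ((hup r hr).trans (le_of_eq ?_)) (by simpa using hlow 0 r hr)
      rw [tsum_eq_single 0 fun n hn => by simp [hN n hn]]
      simp
    have hlim : Tendsto (fun r : ℝ => Real.log (Real.log (M r)) / Real.log r) atTop (nhds 0) := by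
      refine (Real.tendsto_log_atTop.const_div_atTop (Real.log (Real.log ‖a 0‖))).congr' ?_
      filter_upwards [eventually_gt_atTop 0] with r hr
      rw [hconst r hr]
    have hρ0 : ρ = 0 := hρ.trans hlim.limsup_eq
    have hlim' : Tendsto (fun n : ℕ => ((n : ℝ) * Real.log n) / Real.log (1 / ‖a n‖)) atTop
        (nhds 0) := by
      refine tendsto_const_nhds.congr' ?_
      filter_upwards [eventually_gt_atTop 0] with n hn
      simp [hN n hn.ne']
    exact ⟨hρ0.trans hlim'.limsup_eq.symm, fun σ h => absurd hρ0 h.ne'⟩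
end
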